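/- Let ε > 0 and let V : ℝ³ → ℝ be measurable with |V(x)| ≤ C₀ (1+|x|)^{−7−ε}. Set v := |V|^{1/2}, U := sign(V), a^± := (1 ± i)/(8π), and let P := ‖V‖_{L¹}^{−1} v ⟨v, ·⟩ be the rank-one projection onto the span of v and T := U + v G₀ v (where U acts by multiplication and vG₀v has kernel v(x)G₀(x,y)v(y)). For λ > 0 let M^±(λ) := U + v R₀^±(λ⁴) v be the operator on L²(ℝ³) whose kernel is U(x)δ(x−y) plus v(x) R₀^±(λ⁴)(x,y) v(y). Then M^±(λ) = (a^± ‖V‖_{L¹}/λ) P + T + Γ₁^±(λ), where Γ₁^±(λ) is the operator on L²(ℝ³) with integral kernel v(x) [ R₀^±(λ⁴)(x,y) − a^±/λ − G₀(x,y) ] v(y); moreover each Γ₁^±(λ) is bounded on L²(ℝ³), the map λ ↦ Γ₁^±(λ) is twice differentiable in operator norm on (0,∞), and there is a constant C > 0 with ‖Γ₁^±(λ)‖_{L²→L²} + λ ‖∂_λ Γ₁^±(λ)‖_{L²→L²} + λ² ‖∂_λ² Γ₁^±(λ)‖_{L²→L²} ≤ C λ for all λ > 0. -/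

import Mathlib

noncomputable section

open MeasureTheory Real

/-- The free fourth-order resolvent kernel `R₀^±(λ⁴)(x,y)` on `ℝ³`, where the sign is
encoded by `sgn ∈ {1, -1}`. -/
noncomputable def R0ker (sgn lam : ℝ) (x y : EuclideanSpace ℝ (Fin 3)) : ℂ :=
  (1 / (2 * (lam : ℂ) ^ 2)) *
    (Complex.exp ((sgn : ℂ) * Complex.I * (lam : ℂ) * (‖x - y‖ : ℂ)) /
        (4 * (Real.pi : ℂ) * (‖x - y‖ : ℂ)) -
      Complex.exp (-((lam : ℂ) * (‖x - y‖ : ℂ))) / (4 * (Real.pi : ℂ) * (‖x - y‖ : ℂ)))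

/-- `G₀(x,y) = -|x-y|/(8π)`, the kernel of `(Δ²)^{-1}` on `ℝ³`. -/
noncomputable def G0ker (x y : EuclideanSpace ℝ (Fin 3)) : ℝ :=
  -(‖x - y‖ / (8 * Real.pi))

/-- The kernel of the error term `Γ₁^±(λ)`:
`v(x) [ R₀^±(λ⁴)(x,y) - a^±/λ - G₀(x,y) ] v(y)` with `v = |V|^{1/2}` and
`a^± = (1 ± i)/(8π)`. -/
noncomputable def Gamma1ker (V : EuclideanSpace ℝ (Fin 3) → ℝ) (sgn lam : ℝ)
    (x y : EuclideanSpace ℝ (Fin 3)) : ℂ :=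
  (Real.sqrt |V x| : ℂ) *
    (R0ker sgn lam x y - (1 + (sgn : ℂ) * Complex.I) / (8 * (Real.pi : ℂ)) / (lam : ℂ) -
      (G0ker x y : ℂ)) * (Real.sqrt |V y| : ℂ)

section KernelOperators

variable {X : Type*} [MeasurableSpace X] {μ : Measure X}

/-- The bounded operator `T` on `L²(μ)` is the integral operator with kernel `K`. -/
def HasKernel (T : Lp ℂ 2 μ →L[ℂ] Lp ℂ 2 μ) (K : X → X → ℂ) : Prop :=
  ∀ f : Lp ℂ 2 μ, (T f : X → ℂ) =ᵐ[μ] fun x => ∫ y, K x y * f y ∂μ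

lemma integrable_mul_norm {A : X → ℝ} (hA : MemLp A 2 μ) (f : Lp ℂ 2 μ) :
    Integrable (fun y => A y * ‖f y‖) μ :=
  hA.integrable_mul (Lp.memLp f).norm

lemma integral_mul_norm_le {A : X → ℝ} (hA : MemLp A 2 μ) (f : Lp ℂ 2 μ) :
    ∫ y, A y * ‖f y‖ ∂μ ≤ ‖hA.toLp A‖ * ‖f‖ := by
  have hf : MemLp (fun y => ‖f y‖) 2 μ := (Lp.memLp f).norm
  have hnorm : ‖hf.toLp _‖ = ‖f‖ := by
    rw [Lp.norm_toLp, eLpNorm_norm, Lp.norm_def]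
  have hinner : inner ℝ (hA.toLp A) (hf.toLp _) = ∫ y, A y * ‖f y‖ ∂μ := by
    rw [L2.inner_def]
    refine integral_congr_ae ?_
    filter_upwards [hA.coeFn_toLp, hf.coeFn_toLp] with y h1 h2
    rw [h1, h2]
    simp [mul_comm]
  rw [← hinner, ← hnorm]
  exact real_inner_le_norm _ _

lemma integrable_kernel_mul {A : X → ℝ} (hA : MemLp A 2 μ) {K : X → X → ℂ}
    (hK : StronglyMeasurable (Function.uncurry K)) {c : ℝ}
    (hb : ∀ x y, ‖K x y‖ ≤ c * A x * A y) (f : Lp ℂ 2 μ) (x : X) :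
    Integrable (fun y => K x y * f y) μ := by
  refine ((integrable_mul_norm hA f).const_mul (c * A x)).mono'
    ((hK.comp_measurable measurable_prodMk_left).mul
      (Lp.stronglyMeasurable f)).aestronglyMeasurable (.of_forall fun y => ?_)
  rw [norm_mul, ← mul_assoc]
  exact mul_le_mul_of_nonneg_right (hb x y) (norm_nonneg _)

lemma norm_integral_kernel_le {A : X → ℝ} (hA : MemLp A 2 μ) (hA0 : ∀ x, 0 ≤ A x)
    {K : X → X → ℂ} {c : ℝ} (hc : 0 ≤ c) (hb : ∀ x y, ‖K x y‖ ≤ c * A x * A y)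
    (f : Lp ℂ 2 μ) (x : X) :
    ‖∫ y, K x y * f y ∂μ‖ ≤ c * ‖hA.toLp A‖ * ‖f‖ * A x := by
  calc ‖∫ y, K x y * f y ∂μ‖ ≤ ∫ y, c * A x * (A y * ‖f y‖) ∂μ := by
        refine norm_integral_le_of_norm_le ((integrable_mul_norm hA f).const_mul _)
          (.of_forall fun y => ?_)
        rw [norm_mul, ← mul_assoc]
        exact mul_le_mul_of_nonneg_right (hb x y) (norm_nonneg _)
    _ = c * A x * ∫ y, A y * ‖f y‖ ∂μ := integral_const_mul _ _
    _ ≤ c * A x * (‖hA.toLp A‖ * ‖f‖) :=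
        mul_le_mul_of_nonneg_left (integral_mul_norm_le hA f) (mul_nonneg hc (hA0 x))
    _ = c * ‖hA.toLp A‖ * ‖f‖ * A x := by ring

lemma HasKernel.norm_le {A : X → ℝ} (hA : MemLp A 2 μ) (hA0 : ∀ x, 0 ≤ A x)
    {T : Lp ℂ 2 μ →L[ℂ] Lp ℂ 2 μ} {K : X → X → ℂ} (hT : HasKernel T K) {c : ℝ} (hc : 0 ≤ c)
    (hb : ∀ x y, ‖K x y‖ ≤ c * A x * A y) :
    ‖T‖ ≤ c * ‖hA.toLp A‖ ^ 2 := by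
  refine T.opNorm_le_bound (by positivity) fun f => ?_
  have h : ‖T f‖ ≤ c * ‖hA.toLp A‖ * ‖f‖ * ‖hA.toLp A‖ := by
    refine Lp.norm_le_mul_norm_of_ae_le_mul ?_
    filter_upwards [hT f, hA.coeFn_toLp] with x h1 h2
    rw [h1, h2, Real.norm_of_nonneg (hA0 x)]
    exact norm_integral_kernel_le hA hA0 hc hb f x
  exact h.trans_eq (by ring)

lemma exists_hasKernel [SFinite μ] {A : X → ℝ} (hA : MemLp A 2 μ) (hA0 : ∀ x, 0 ≤ A x)
    {K : X → X → ℂ} (hK : StronglyMeasurable (Function.uncurry K)) {c : ℝ} (hc : 0 ≤ c)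
    (hb : ∀ x y, ‖K x y‖ ≤ c * A x * A y) :
    ∃ T : Lp ℂ 2 μ →L[ℂ] Lp ℂ 2 μ, HasKernel T K := by
  have hmem (f : Lp ℂ 2 μ) : MemLp (fun x => ∫ y, K x y * f y ∂μ) 2 μ := by
    refine MemLp.of_le_mul (c := c * ‖hA.toLp A‖ * ‖f‖) hA ?_ (.of_forall fun x => ?_)
    · have : StronglyMeasurable (Function.uncurry fun x y => K x y * f y) :=
        hK.mul ((Lp.stronglyMeasurable f).comp_measurable measurable_snd)
      exact this.integral_prod_right.aestronglyMeasurable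
    · rw [Real.norm_of_nonneg (hA0 x)]
      exact norm_integral_kernel_le hA hA0 hc hb f x
  let L : Lp ℂ 2 μ →ₗ[ℂ] Lp ℂ 2 μ :=
    { toFun := fun f => (hmem f).toLp _
      map_add' := fun f g => by
        rw [← MemLp.toLp_add]
        refine MemLp.toLp_congr _ _ (.of_forall fun x => ?_)
        simp only [Pi.add_apply]
        rw [← integral_add (integrable_kernel_mul hA hK hb f x)
          (integrable_kernel_mul hA hK hb g x)]
        refine integral_congr_ae ?_
        filter_upwards [Lp.coeFn_add f g] with y hy
        rw [hy, Pi.add_apply, mul_add]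
      map_smul' := fun a f => by
        rw [RingHom.id_apply, ← MemLp.toLp_const_smul]
        refine MemLp.toLp_congr _ _ (.of_forall fun x => ?_)
        simp only [Pi.smul_apply, smul_eq_mul]
        rw [← integral_const_mul]
        refine integral_congr_ae ?_
        filter_upwards [Lp.coeFn_smul a f] with y hy
        rw [hy, Pi.smul_apply, smul_eq_mul]
        ring }
  refine ⟨L.mkContinuous (c * ‖hA.toLp A‖ * ‖hA.toLp A‖) fun f => ?_, fun f =>
    (hmem f).coeFn_toLp⟩
  have h : ‖L f‖ ≤ c * ‖hA.toLp A‖ * ‖f‖ * ‖hA.toLp A‖ := by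
    refine Lp.norm_le_mul_norm_of_ae_le_mul ?_
    filter_upwards [(hmem f).coeFn_toLp, hA.coeFn_toLp] with x h1 h2
    rw [h2, Real.norm_of_nonneg (hA0 x)]
    refine (congrArg norm h1).trans_le ?_
    exact norm_integral_kernel_le hA hA0 hc hb f x
  exact h.trans_eq (by ring)

lemma HasKernel.sub_sub_smul {T₁ T₂ T₃ : Lp ℂ 2 μ →L[ℂ] Lp ℂ 2 μ} {K₁ K₂ K₃ : X → X → ℂ}
    (h₁ : HasKernel T₁ K₁) (h₂ : HasKernel T₂ K₂) (h₃ : HasKernel T₃ K₃)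
    (i₁ : ∀ (f : Lp ℂ 2 μ) x, Integrable (fun y => K₁ x y * f y) μ)
    (i₂ : ∀ (f : Lp ℂ 2 μ) x, Integrable (fun y => K₂ x y * f y) μ)
    (i₃ : ∀ (f : Lp ℂ 2 μ) x, Integrable (fun y => K₃ x y * f y) μ) (t : ℝ) :
    HasKernel (T₁ - T₂ - t • T₃) fun x y => K₁ x y - K₂ x y - t * K₃ x y := by
  intro f
  have e : (T₁ - T₂ - t • T₃) f = T₁ f - T₂ f - (t : ℂ) • T₃ f := rfl
  rw [e]
  filter_upwards [h₁ f, h₂ f, h₃ f, Lp.coeFn_sub (T₁ f - T₂ f) ((t : ℂ) • T₃ f),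
    Lp.coeFn_sub (T₁ f) (T₂ f), Lp.coeFn_smul (t : ℂ) (T₃ f)] with x e₁ e₂ e₃ e₄ e₅ e₆
  have i₁₂ : Integrable (fun y => K₁ x y * f y - K₂ x y * f y) μ := (i₁ f x).sub (i₂ f x)
  rw [e₄, Pi.sub_apply, e₅, e₆, Pi.sub_apply, Pi.smul_apply, e₁, e₂, e₃, smul_eq_mul,
    ← integral_const_mul, ← integral_sub (i₁ f x) (i₂ f x),
    ← integral_sub i₁₂ ((i₃ f x).const_mul _)]
  refine integral_congr_ae (.of_forall fun y => ?_)
  simp only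
  ring

/-- A second-order Taylor estimate on a half-line. -/
lemma norm_taylor_le {k k' k'' : ℝ → ℂ} {δ B : ℝ} (h : ∀ t, δ ≤ t → HasDerivAt k (k' t) t)
    (h' : ∀ t, δ ≤ t → HasDerivAt k' (k'' t) t) (hB : ∀ t, δ ≤ t → ‖k'' t‖ ≤ B)
    {s t : ℝ} (hs : δ ≤ s) (ht : δ ≤ t) :
    ‖k t - k s - ((t - s : ℝ) : ℂ) * k' s‖ ≤ B * |t - s| ^ 2 := by
  have hB0 : 0 ≤ B := (norm_nonneg _).trans (hB s hs)
  have hsub : ∀ u ∈ Set.uIcc s t, δ ≤ u := fun u hu => (le_min hs ht).trans hu.1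
  have h1 : ∀ u ∈ Set.uIcc s t, ‖k' u - k' s‖ ≤ B * |t - s| := by
    intro u hu
    refine ((convex_uIcc s t).norm_image_sub_le_of_norm_hasDerivWithin_le
      (fun w hw => (h' w (hsub w hw)).hasDerivWithinAt) (fun w hw => hB w (hsub w hw))
      Set.left_mem_uIcc hu).trans ?_
    exact mul_le_mul_of_nonneg_left (Set.abs_sub_left_of_mem_uIcc hu) hB0
  have h2 := (convex_uIcc s t).norm_image_sub_le_of_norm_hasDerivWithin_le
    (f := fun u : ℝ => k u - (u : ℂ) * k' s) (f' := fun u => k' u - 1 * k' s)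
    (fun u hu => ((h u (hsub u hu)).sub
      ((Complex.ofRealCLM.hasDerivAt (x := u)).mul_const (k' s))).hasDerivWithinAt)
    (fun u hu => by simpa using h1 u hu) Set.left_mem_uIcc Set.right_mem_uIcc
  calc ‖k t - k s - ((t - s : ℝ) : ℂ) * k' s‖
      = ‖k t - (t : ℂ) * k' s - (k s - (s : ℂ) * k' s)‖ := by
        congr 1
        push_cast
        ring
    _ ≤ B * |t - s| * ‖t - s‖ := h2
    _ = B * |t - s| ^ 2 := by rw [Real.norm_eq_abs]; ring

/-- A family of integral operators is differentiable in operator norm when its kernel is twice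
differentiable in the parameter, with a second derivative dominated by `A ⊗ A`. -/
lemma hasDerivAt_of_hasKernel {A : X → ℝ} (hA : MemLp A 2 μ) (hA0 : ∀ x, 0 ≤ A x)
    {K K' K'' : ℝ → X → X → ℂ} {T T' : ℝ → Lp ℂ 2 μ →L[ℂ] Lp ℂ 2 μ}
    (hT : ∀ t, 0 < t → HasKernel (T t) (K t)) (hT' : ∀ t, 0 < t → HasKernel (T' t) (K' t))
    (i : ∀ t, 0 < t → ∀ (f : Lp ℂ 2 μ) x, Integrable (fun y => K t x y * f y) μ)
    (i' : ∀ t, 0 < t → ∀ (f : Lp ℂ 2 μ) x, Integrable (fun y => K' t x y * f y) μ)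
    (hK : ∀ t, 0 < t → ∀ x y, HasDerivAt (fun s => K s x y) (K' t x y) t)
    (hK' : ∀ t, 0 < t → ∀ x y, HasDerivAt (fun s => K' s x y) (K'' t x y) t)
    (hb : ∀ δ, 0 < δ → ∃ B, 0 ≤ B ∧ ∀ t, δ ≤ t → ∀ x y, ‖K'' t x y‖ ≤ B * A x * A y)
    {s : ℝ} (hs : 0 < s) : HasDerivAt T (T' s) s := by
  obtain ⟨B, hB0, hB⟩ := hb (s / 2) (by positivity)
  rw [hasDerivAt_iff_isLittleO]
  refine Asymptotics.IsBigO.trans_isLittleO (g := fun t => |t - s| ^ 2) ?_ ?_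
  · refine Asymptotics.IsBigO.of_bound (B * ‖hA.toLp A‖ ^ 2) ?_
    filter_upwards [lt_mem_nhds (half_lt_self hs)] with t ht
    have ht0 : 0 < t := (half_pos hs).trans ht
    have hk := (hT t ht0).sub_sub_smul (hT s hs) (hT' s hs) (i t ht0) (i s hs) (i' s hs) (t - s)
    have := hk.norm_le hA hA0 (c := B * |t - s| ^ 2) (by positivity) fun x y => by
      refine (norm_taylor_le (k := fun s => K s x y) (k' := fun s => K' s x y)
        (k'' := fun s => K'' s x y) (δ := s / 2)
        (fun u hu => hK u (by linarith) x y) (fun u hu => hK' u (by linarith) x y)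
        (fun u hu => hB u hu x y) (half_le_self hs.le) ht.le).trans_eq ?_
      ring
    rw [Real.norm_of_nonneg (by positivity : 0 ≤ |t - s| ^ 2)]
    exact this.trans_eq (by ring)
  · have h : (fun t : ℝ => |t - s| ^ 2) = fun t => ‖t - s‖ ^ 2 := rfl
    rw [h]
    have := Asymptotics.isLittleO_pow_id (𝕜 := ℝ) (n := 2) one_lt_two
    have h0 : Filter.Tendsto (fun t : ℝ => t - s) (nhds s) (nhds 0) := by
      have : Filter.Tendsto (fun t : ℝ => t - s) (nhds s) (nhds (s - s)) :=
        (continuous_id.sub continuous_const).tendsto s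
      rwa [sub_self] at this
    simpa [Function.comp_def] using (this.comp_tendsto h0)

end KernelOperators

section ScalarBounds

/-- The third-order Taylor remainder at `0` of `e^{iσs} - e^{-s}`, when `σ² = 1`. -/
def expRem (σ s : ℝ) : ℂ :=
  Complex.exp (σ * Complex.I * s) - Complex.exp (-s) - (1 + σ * Complex.I) * s + s ^ 2

/-- The first derivative of `expRem`. -/
def expRem₁ (σ s : ℝ) : ℂ :=
  σ * Complex.I * Complex.exp (σ * Complex.I * s) + Complex.exp (-s) - (1 + σ * Complex.I) + 2 * s

/-- The second derivative of `expRem`. -/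
def expRem₂ (σ s : ℝ) : ℂ :=
  (σ * Complex.I) ^ 2 * Complex.exp (σ * Complex.I * s) - Complex.exp (-s) + 2

/-- The third derivative of `expRem`. -/
def expRem₃ (σ s : ℝ) : ℂ :=
  (σ * Complex.I) ^ 3 * Complex.exp (σ * Complex.I * s) + Complex.exp (-s)

lemma hasDerivAt_cexp_mul_ofReal (z : ℂ) (s : ℝ) :
    HasDerivAt (fun s : ℝ => Complex.exp (z * s)) (z * Complex.exp (z * s)) s := by
  have h := ((Complex.ofRealCLM.hasDerivAt (x := s)).const_mul z).cexp
  simpa [mul_comm] using h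

lemma hasDerivAt_cexp_neg_ofReal (s : ℝ) :
    HasDerivAt (fun s : ℝ => Complex.exp (-s)) (-Complex.exp (-s)) s := by
  simpa using hasDerivAt_cexp_mul_ofReal (-1) s

lemma hasDerivAt_expRem (σ s : ℝ) : HasDerivAt (expRem σ) (expRem₁ σ s) s := by
  have hid : HasDerivAt (fun s : ℝ => (s : ℂ)) 1 s := Complex.ofRealCLM.hasDerivAt
  have := (((hasDerivAt_cexp_mul_ofReal (σ * Complex.I) s).sub
    (hasDerivAt_cexp_neg_ofReal s)).sub (hid.const_mul (1 + σ * Complex.I))).add (hid.pow 2)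
  refine this.congr_deriv ?_
  simp [expRem₁]

lemma hasDerivAt_expRem₁ (σ s : ℝ) : HasDerivAt (expRem₁ σ) (expRem₂ σ s) s := by
  have hid : HasDerivAt (fun s : ℝ => (s : ℂ)) 1 s := Complex.ofRealCLM.hasDerivAt
  have := ((((hasDerivAt_cexp_mul_ofReal (σ * Complex.I) s).const_mul (σ * Complex.I)).add
    (hasDerivAt_cexp_neg_ofReal s)).sub_const (1 + σ * Complex.I)).add (hid.const_mul 2)
  refine this.congr_deriv ?_
  simp only [expRem₂]
  ring

lemma hasDerivAt_expRem₂ (σ s : ℝ) : HasDerivAt (expRem₂ σ) (expRem₃ σ s) s := by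
  have := (((hasDerivAt_cexp_mul_ofReal (σ * Complex.I) s).const_mul
    ((σ * Complex.I) ^ 2)).sub (hasDerivAt_cexp_neg_ofReal s)).add_const 2
  refine this.congr_deriv ?_
  simp only [expRem₃]
  ring

lemma norm_le_mul_of_hasDerivAt {F F' : ℝ → ℂ} (h : ∀ s, HasDerivAt F (F' s) s) (h0 : F 0 = 0)
    {n : ℕ} (hb : ∀ s, 0 ≤ s → ‖F' s‖ ≤ 2 * s ^ n) {s : ℝ} (hs : 0 ≤ s) :
    ‖F s‖ ≤ 2 * s ^ (n + 1) := by
  have := (convex_Icc 0 s).norm_image_sub_le_of_norm_hasDerivWithin_le (C := 2 * s ^ n)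
    (fun u _ => (h u).hasDerivWithinAt)
    (fun u hu => (hb u hu.1).trans (by have := hu.1; have := hu.2; gcongr))
    (Set.left_mem_Icc.2 hs) (Set.right_mem_Icc.2 hs)
  rw [h0, sub_zero, sub_zero, Real.norm_of_nonneg hs] at this
  exact this.trans_eq (by ring)

variable {σ : ℝ}

lemma norm_expRem₃_le (hσ : |σ| = 1) {s : ℝ} (hs : 0 ≤ s) : ‖expRem₃ σ s‖ ≤ 2 := by
  have h1 : ‖Complex.exp (σ * Complex.I * s)‖ = 1 := by
    rw [Complex.norm_exp]
    simp
  have h2 : ‖Complex.exp (-s)‖ ≤ 1 := by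
    rw [Complex.norm_exp]
    simpa using hs
  refine (norm_add_le _ _).trans ?_
  rw [norm_mul, h1, norm_pow, norm_mul, Complex.norm_I, Complex.norm_real, Real.norm_eq_abs, hσ]
  linarith

lemma norm_expRem₂_le (hσ : |σ| = 1) {s : ℝ} (hs : 0 ≤ s) : ‖expRem₂ σ s‖ ≤ 2 * s := by
  have hσ2 : (σ : ℂ) ^ 2 = 1 := by
    have : σ ^ 2 = 1 := by rw [← sq_abs, hσ, one_pow]
    exact_mod_cast this
  have h0 : expRem₂ σ 0 = 0 := by
    simp [expRem₂, mul_pow, hσ2]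
    norm_num
  simpa using norm_le_mul_of_hasDerivAt (n := 0) (hasDerivAt_expRem₂ σ) h0
    (fun u hu => by simpa using norm_expRem₃_le hσ hu) hs

lemma norm_expRem₁_le (hσ : |σ| = 1) {s : ℝ} (hs : 0 ≤ s) : ‖expRem₁ σ s‖ ≤ 2 * s ^ 2 :=
  norm_le_mul_of_hasDerivAt (n := 1) (hasDerivAt_expRem₁ σ) (by simp [expRem₁]; ring)
    (fun u hu => by simpa using norm_expRem₂_le hσ hu) hs

lemma norm_expRem_le (hσ : |σ| = 1) {s : ℝ} (hs : 0 ≤ s) : ‖expRem σ s‖ ≤ 2 * s ^ 3 :=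
  norm_le_mul_of_hasDerivAt (n := 2) (hasDerivAt_expRem σ) (by simp [expRem])
    (fun u hu => norm_expRem₁_le hσ hu) hs

/-- The scalar function `R₀^±(λ⁴) - a^±/λ - G₀` of `λ = t` and `r = |x - y|`. -/
def radRem (σ t r : ℝ) : ℂ :=
  1 / (8 * π * r) * (expRem σ (t * r) / t ^ 2)

/-- The first `t`-derivative of `radRem`. -/
def radRem₁ (σ t r : ℝ) : ℂ :=
  1 / (8 * π * r) * (r * expRem₁ σ (t * r) / t ^ 2 - 2 * expRem σ (t * r) / t ^ 3)

/-- The second `t`-derivative of `radRem`. -/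
def radRem₂ (σ t r : ℝ) : ℂ :=
  1 / (8 * π * r) * (r ^ 2 * expRem₂ σ (t * r) / t ^ 2 - 4 * r * expRem₁ σ (t * r) / t ^ 3
    + 6 * expRem σ (t * r) / t ^ 4)

/-- The third `t`-derivative of `radRem`. -/
def radRem₃ (σ t r : ℝ) : ℂ :=
  1 / (8 * π * r) * (r ^ 3 * expRem₃ σ (t * r) / t ^ 2 - 6 * r ^ 2 * expRem₂ σ (t * r) / t ^ 3
    + 18 * r * expRem₁ σ (t * r) / t ^ 4 - 24 * expRem σ (t * r) / t ^ 5)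

lemma hasDerivAt_comp_mul_div_pow {F F' : ℝ → ℂ} (h : ∀ s, HasDerivAt F (F' s) s) (n : ℕ)
    (c : ℂ) (r : ℝ) {t : ℝ} (ht : 0 < t) :
    HasDerivAt (fun t : ℝ => c * F (t * r) / t ^ n)
      (c * (r * F' (t * r)) / t ^ n - n * (c * F (t * r)) / t ^ (n + 1)) t := by
  have ht' : (t : ℂ) ≠ 0 := by exact_mod_cast ht.ne'
  have h1 : HasDerivAt (fun t : ℝ => F (t * r)) (r * F' (t * r)) t := by
    have := (h (t * r)).scomp t ((hasDerivAt_id t).mul_const r)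
    simpa [Function.comp_def] using this
  have h2 : HasDerivAt (fun t : ℝ => (t : ℂ) ^ n) (n * (t : ℂ) ^ (n - 1) * 1) t :=
    (Complex.ofRealCLM.hasDerivAt (x := t)).pow n
  refine ((h1.const_mul c).div h2 (pow_ne_zero n ht')).congr_deriv ?_
  rcases n with _ | n
  · simp
  · field_simp
    simp
    ring

lemma hasDerivAt_radRem {t : ℝ} (ht : 0 < t) (r : ℝ) :
    HasDerivAt (fun t => radRem σ t r) (radRem₁ σ t r) t := by
  have := (hasDerivAt_comp_mul_div_pow (hasDerivAt_expRem σ) 2 1 r ht).const_mul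
    (1 / (8 * π * r) : ℂ)
  simpa only [radRem, radRem₁, one_mul, Nat.cast_ofNat] using this

lemma hasDerivAt_radRem₁ {t : ℝ} (ht : 0 < t) (r : ℝ) :
    HasDerivAt (fun t => radRem₁ σ t r) (radRem₂ σ t r) t := by
  have := ((hasDerivAt_comp_mul_div_pow (hasDerivAt_expRem₁ σ) 2 r r ht).sub
    (hasDerivAt_comp_mul_div_pow (hasDerivAt_expRem σ) 3 2 r ht)).const_mul
    (1 / (8 * π * r) : ℂ)
  refine this.congr_deriv ?_
  simp only [radRem₂]
  push_cast
  ring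

lemma hasDerivAt_radRem₂ {t : ℝ} (ht : 0 < t) (r : ℝ) :
    HasDerivAt (fun t => radRem₂ σ t r) (radRem₃ σ t r) t := by
  have := (((hasDerivAt_comp_mul_div_pow (hasDerivAt_expRem₂ σ) 2 (r ^ 2) r ht).sub
    (hasDerivAt_comp_mul_div_pow (hasDerivAt_expRem₁ σ) 3 (4 * r) r ht)).add
    (hasDerivAt_comp_mul_div_pow (hasDerivAt_expRem σ) 4 6 r ht)).const_mul
    (1 / (8 * π * r) : ℂ)
  refine this.congr_deriv ?_
  simp only [radRem₃]
  push_cast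
  ring

lemma norm_inv_mul_le {r : ℝ} (hr : 0 ≤ r) {z : ℂ} {c : ℝ} (hc : 0 ≤ c) (hz : ‖z‖ ≤ c * r ^ 3) :
    ‖1 / (8 * π * r) * z‖ ≤ c * r ^ 2 := by
  rcases hr.eq_or_lt with rfl | hr
  · simp
  have h : ‖(1 / (8 * π * r) : ℂ)‖ = 1 / (8 * π * r) := by
    simp [abs_of_pos hr, abs_of_pos pi_pos]
  rw [norm_mul, h, one_div, inv_mul_le_iff₀ (by positivity)]
  have : 1 ≤ 8 * π := by linarith [pi_gt_three]
  calc ‖z‖ ≤ 1 * (c * r ^ 3) := by rwa [one_mul]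
    _ ≤ 8 * π * (c * r ^ 3) := by gcongr
    _ = 8 * π * r * (c * r ^ 2) := by ring

lemma norm_term_le {m : ℕ} {a r t : ℝ} (ha : 0 ≤ a) (hr : 0 ≤ r) (ht : 0 < t) {z w : ℂ}
    (hw : ‖w‖ = a * r ^ m) {j : ℕ} (hz : ‖z‖ ≤ 2 * (t * r) ^ j) (n : ℕ) :
    ‖w * z / t ^ n‖ ≤ 2 * a * (r ^ (m + j) * t ^ j / t ^ n) := by
  rw [norm_div, norm_mul, hw, norm_pow, Complex.norm_real, Real.norm_of_nonneg ht.le]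
  calc a * r ^ m * ‖z‖ / t ^ n ≤ a * r ^ m * (2 * (t * r) ^ j) / t ^ n := by gcongr
    _ = _ := by ring

variable {t r : ℝ}

lemma norm_radRem_le (hσ : |σ| = 1) (ht : 0 < t) (hr : 0 ≤ r) :
    ‖radRem σ t r‖ ≤ 2 * t * r ^ 2 := by
  have hs : 0 ≤ t * r := by positivity
  refine norm_inv_mul_le hr (by positivity) ?_
  have h := norm_term_le (m := 0) zero_le_one hr ht (w := 1) (by simp) (norm_expRem_le hσ hs) 2
  rw [one_mul] at h
  refine h.trans_eq ?_
  field_simp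

lemma norm_radRem₁_le (hσ : |σ| = 1) (ht : 0 < t) (hr : 0 ≤ r) :
    ‖radRem₁ σ t r‖ ≤ 6 * r ^ 2 := by
  have hs : 0 ≤ t * r := by positivity
  refine norm_inv_mul_le hr (by positivity) ?_
  have h0 := norm_term_le (m := 0) zero_le_two hr ht (w := 2) (by simp) (norm_expRem_le hσ hs) 3
  have h1 := norm_term_le (m := 1) zero_le_one hr ht (w := r) (by simp [abs_of_nonneg hr])
    (norm_expRem₁_le hσ hs) 2
  refine ((norm_sub_le _ _).trans (add_le_add h1 h0)).trans_eq ?_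
  field_simp
  ring

lemma norm_radRem₂_le (hσ : |σ| = 1) (ht : 0 < t) (hr : 0 ≤ r) :
    ‖radRem₂ σ t r‖ ≤ 22 / t * r ^ 2 := by
  have hs : 0 ≤ t * r := by positivity
  refine norm_inv_mul_le hr (by positivity) ?_
  have h0 := norm_term_le (m := 0) (a := 6) (by norm_num) hr ht (w := 6) (by simp)
    (norm_expRem_le hσ hs) 4
  have h1 := norm_term_le (m := 1) (a := 4) (by norm_num) hr ht (w := 4 * r)
    (by simp [abs_of_nonneg hr]) (norm_expRem₁_le hσ hs) 3
  have h2 := norm_term_le (m := 2) (j := 1) zero_le_one hr ht (w := r ^ 2) (by simp)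
    (by simpa using norm_expRem₂_le hσ hs) 2
  refine ((norm_add_le _ _).trans (add_le_add ((norm_sub_le _ _).trans
    (add_le_add h2 h1)) h0)).trans_eq ?_
  field_simp
  ring

lemma norm_radRem₃_le (hσ : |σ| = 1) (ht : 0 < t) (hr : 0 ≤ r) :
    ‖radRem₃ σ t r‖ ≤ 98 / t ^ 2 * r ^ 2 := by
  have hs : 0 ≤ t * r := by positivity
  refine norm_inv_mul_le hr (by positivity) ?_
  have h0 := norm_term_le (m := 0) (a := 24) (by norm_num) hr ht (w := 24) (by simp)
    (norm_expRem_le hσ hs) 5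
  have h1 := norm_term_le (m := 1) (a := 18) (by norm_num) hr ht (w := 18 * r)
    (by simp [abs_of_nonneg hr]) (norm_expRem₁_le hσ hs) 4
  have h2 := norm_term_le (m := 2) (j := 1) (a := 6) (by norm_num) hr ht (w := 6 * r ^ 2) (by simp)
    (by simpa using norm_expRem₂_le hσ hs) 3
  have h3 := norm_term_le (m := 3) (j := 0) zero_le_one hr ht (w := r ^ 3)
    (by simp [abs_of_nonneg hr]) (by simpa using norm_expRem₃_le hσ hs) 2
  refine ((norm_sub_le _ _).trans (add_le_add ((norm_add_le _ _).trans (add_le_add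
    ((norm_sub_le _ _).trans (add_le_add h3 h2)) h1)) h0)).trans_eq ?_
  field_simp
  ring

end ScalarBounds

section WeightedKernel

/-- The kernel `v(x) q(|x - y|) v(y)` with `v = |V|^{1/2}`. -/
def radKernel (V : EuclideanSpace ℝ (Fin 3) → ℝ) (q : ℝ → ℂ) (x y : EuclideanSpace ℝ (Fin 3)) :
    ℂ :=
  √|V x| * q ‖x - y‖ * √|V y|

/-- The weight `v(x) (1 + |x|)²`. -/
def weight (V : EuclideanSpace ℝ (Fin 3) → ℝ) (x : EuclideanSpace ℝ (Fin 3)) : ℝ :=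
  √|V x| * (1 + ‖x‖) ^ 2

variable {V : EuclideanSpace ℝ (Fin 3) → ℝ}

lemma weight_nonneg (x : EuclideanSpace ℝ (Fin 3)) : 0 ≤ weight V x := by
  unfold weight
  positivity

lemma memLp_weight {ε C₀ : ℝ} (hε : 0 < ε) (hV : Measurable V)
    (hdecay : ∀ x, |V x| ≤ C₀ * (1 + ‖x‖) ^ (-(7 + ε))) : MemLp (weight V) 2 volume := by
  have hm : Measurable (weight V) := by
    unfold weight
    fun_prop
  rw [memLp_two_iff_integrable_sq hm.aestronglyMeasurable]
  have hint : Integrable (fun x : EuclideanSpace ℝ (Fin 3) => (1 + ‖x‖) ^ (-(3 + ε))) :=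
    integrable_one_add_norm (by simp; linarith)
  refine (hint.const_mul C₀).mono' (hm.pow_const 2).aestronglyMeasurable (.of_forall fun x => ?_)
  have hx : 0 < 1 + ‖x‖ := by positivity
  rw [Real.norm_of_nonneg (sq_nonneg _), weight, mul_pow, Real.sq_sqrt (abs_nonneg _), ← pow_mul]
  calc |V x| * (1 + ‖x‖) ^ (2 * 2)
      ≤ C₀ * (1 + ‖x‖) ^ (-(7 + ε)) * (1 + ‖x‖) ^ (2 * 2) := by gcongr; exact hdecay x
    _ = C₀ * (1 + ‖x‖) ^ (-(3 + ε)) := by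
        rw [mul_assoc, ← Real.rpow_natCast, ← Real.rpow_add hx]
        congr 2
        push_cast
        ring

lemma norm_radKernel_le {q : ℝ → ℂ} {c : ℝ} (hc : 0 ≤ c) (hq : ∀ r, 0 ≤ r → ‖q r‖ ≤ c * r ^ 2)
    (x y : EuclideanSpace ℝ (Fin 3)) : ‖radKernel V q x y‖ ≤ c * weight V x * weight V y := by
  have hxy : ‖x - y‖ ≤ (1 + ‖x‖) * (1 + ‖y‖) := by
    nlinarith [norm_sub_le x y, norm_nonneg x, norm_nonneg y,
      mul_nonneg (norm_nonneg x) (norm_nonneg y)]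
  rw [radKernel, norm_mul, norm_mul, Complex.norm_real, Complex.norm_real,
    Real.norm_of_nonneg (Real.sqrt_nonneg _), Real.norm_of_nonneg (Real.sqrt_nonneg _)]
  calc √|V x| * ‖q ‖x - y‖‖ * √|V y|
      ≤ √|V x| * (c * ((1 + ‖x‖) * (1 + ‖y‖)) ^ 2) * √|V y| := by
        gcongr
        exact (hq _ (norm_nonneg _)).trans (by gcongr)
    _ = c * weight V x * weight V y := by
        unfold weight
        ring

lemma stronglyMeasurable_radKernel (hV : Measurable V) {q : ℝ → ℂ} (hq : Measurable q) :
    StronglyMeasurable (Function.uncurry (radKernel V q)) := by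
  refine Measurable.stronglyMeasurable ?_
  unfold radKernel Function.uncurry
  fun_prop

lemma hasDerivAt_radKernel {q : ℝ → ℝ → ℂ} {q' : ℝ → ℂ} {t : ℝ}
    (h : ∀ r, HasDerivAt (fun s => q s r) (q' r) t) (x y : EuclideanSpace ℝ (Fin 3)) :
    HasDerivAt (fun s => radKernel V (q s) x y) (radKernel V q' x y) t :=
  ((h ‖x - y‖).const_mul _).mul_const _

lemma radKernel_radRem_eq {σ t : ℝ} (ht : 0 < t) {x y : EuclideanSpace ℝ (Fin 3)} (hxy : x ≠ y) :
    radKernel V (radRem σ t) x y = Gamma1ker V σ t x y := by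
  have hr : (‖x - y‖ : ℂ) ≠ 0 := by exact_mod_cast (norm_pos_iff.2 (sub_ne_zero.2 hxy)).ne'
  have ht' : (t : ℂ) ≠ 0 := by exact_mod_cast ht.ne'
  have hπ : (π : ℂ) ≠ 0 := by exact_mod_cast pi_ne_zero
  unfold radKernel Gamma1ker
  congr 2
  simp only [radRem, expRem, R0ker, G0ker]
  push_cast
  rw [← mul_assoc (σ * Complex.I) (t : ℂ)]
  field_simp
  ring

end WeightedKernel

/-- Lemma 3.1(i): with `|V(x)| ≲ (1+|x|)^{-7-ε}`, `v = |V|^{1/2}`,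
`a^± = (1±i)/(8π)`, the operator `M^±(λ) = U + v R₀^±(λ⁴) v` satisfies
`M^±(λ) = (a^± ‖V‖_{L¹}/λ) P + T + Γ₁^±(λ)`: at the kernel level,
`v(x) R₀^±(λ⁴)(x,y) v(y)` equals `(a^±‖V‖₁/λ) · (‖V‖₁⁻¹ v(x)v(y)) + v(x)G₀(x,y)v(y)` plus
the kernel of `Γ₁^±(λ)`; moreover `Γ₁^±(λ)` is bounded on `L²`, twice differentiable in
operator norm in `λ > 0`, and `‖Γ₁^±(λ)‖ + λ‖∂_λΓ₁^±(λ)‖ + λ²‖∂_λ²Γ₁^±(λ)‖ ≤ C λ`. -/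
theorem stmt18 (ε C₀ : ℝ) (hε : 0 < ε) (V : EuclideanSpace ℝ (Fin 3) → ℝ)
    (hVmeas : Measurable V) (hVdecay : ∀ x, |V x| ≤ C₀ * (1 + ‖x‖) ^ (-(7 + ε)))
    (hV1 : 0 < ∫ x : EuclideanSpace ℝ (Fin 3), |V x|) :
    ∃ C : ℝ, 0 < C ∧ ∀ sgn : ℝ, (sgn = 1 ∨ sgn = -1) →
      ∃ Γ : ℝ → (Lp ℂ 2 (volume : Measure (EuclideanSpace ℝ (Fin 3))) →L[ℂ]
          Lp ℂ 2 (volume : Measure (EuclideanSpace ℝ (Fin 3)))),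
        (∀ lam : ℝ, 0 < lam → ∀ x y : EuclideanSpace ℝ (Fin 3),
          (Real.sqrt |V x| : ℂ) * R0ker sgn lam x y * (Real.sqrt |V y| : ℂ)
            = ((1 + (sgn : ℂ) * Complex.I) / (8 * (Real.pi : ℂ)) *
                  (((∫ z : EuclideanSpace ℝ (Fin 3), |V z|) : ℝ) : ℂ) / (lam : ℂ)) *
                ((((∫ z : EuclideanSpace ℝ (Fin 3), |V z|)⁻¹ : ℝ) : ℂ) *
                  (Real.sqrt |V x| : ℂ) * (Real.sqrt |V y| : ℂ))
              + (Real.sqrt |V x| : ℂ) * (G0ker x y : ℂ) * (Real.sqrt |V y| : ℂ)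
              + Gamma1ker V sgn lam x y) ∧
        (∀ lam : ℝ, 0 < lam →
          ∀ f : Lp ℂ 2 (volume : Measure (EuclideanSpace ℝ (Fin 3))),
            (Γ lam f : EuclideanSpace ℝ (Fin 3) → ℂ) =ᵐ[volume]
              fun x => ∫ y : EuclideanSpace ℝ (Fin 3), Gamma1ker V sgn lam x y * f y) ∧
        (∀ lam : ℝ, 0 < lam → DifferentiableAt ℝ Γ lam) ∧
        (∀ lam : ℝ, 0 < lam → DifferentiableAt ℝ (deriv Γ) lam) ∧
        (∀ lam : ℝ, 0 < lam →
          ‖Γ lam‖ + lam * ‖deriv Γ lam‖ + lam ^ 2 * ‖deriv (deriv Γ) lam‖ ≤ C * lam) := by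
  have hA := memLp_weight hε hVmeas hVdecay
  have hA0 := weight_nonneg (V := V)
  set S := ‖hA.toLp (weight V)‖ ^ 2
  refine ⟨30 * S + 1, by positivity, fun σ hσ => ?_⟩
  have hσ' : |σ| = 1 := by rcases hσ with rfl | rfl <;> simp
  have b₀ (t : ℝ) (ht : 0 < t) := norm_radKernel_le (V := V) (by positivity)
    fun r hr => norm_radRem_le hσ' ht hr
  have b₁ (t : ℝ) (ht : 0 < t) := norm_radKernel_le (V := V) (by norm_num)
    fun r hr => norm_radRem₁_le hσ' ht hr
  have b₂ (t : ℝ) (ht : 0 < t) := norm_radKernel_le (V := V) (by positivity)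
    fun r hr => norm_radRem₂_le hσ' ht hr
  have b₃ (t : ℝ) (ht : 0 < t) := norm_radKernel_le (V := V) (by positivity)
    fun r hr => norm_radRem₃_le hσ' ht hr
  have m₀ (t : ℝ) := stronglyMeasurable_radKernel hVmeas (q := radRem σ t)
    (by unfold radRem expRem; fun_prop)
  have m₁ (t : ℝ) := stronglyMeasurable_radKernel hVmeas (q := radRem₁ σ t)
    (by unfold radRem₁ expRem₁ expRem; fun_prop)
  have m₂ (t : ℝ) := stronglyMeasurable_radKernel hVmeas (q := radRem₂ σ t)
    (by unfold radRem₂ expRem₂ expRem₁ expRem; fun_prop)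
  choose! Γ₀ k₀ using fun t (ht : 0 < t) =>
    exists_hasKernel hA hA0 (m₀ t) (by positivity) (b₀ t ht)
  choose! Γ₁ k₁ using fun t (ht : 0 < t) =>
    exists_hasKernel hA hA0 (m₁ t) (by positivity) (b₁ t ht)
  choose! Γ₂ k₂ using fun t (ht : 0 < t) =>
    exists_hasKernel hA hA0 (m₂ t) (by positivity) (b₂ t ht)
  have i₀ (t : ℝ) (ht : 0 < t) := integrable_kernel_mul hA (m₀ t) (b₀ t ht)
  have i₁ (t : ℝ) (ht : 0 < t) := integrable_kernel_mul hA (m₁ t) (b₁ t ht)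
  have i₂ (t : ℝ) (ht : 0 < t) := integrable_kernel_mul hA (m₂ t) (b₂ t ht)
  have d₀ (t : ℝ) (ht : 0 < t) : HasDerivAt Γ₀ (Γ₁ t) t :=
    hasDerivAt_of_hasKernel hA hA0 k₀ k₁ i₀ i₁
      (fun s hs => hasDerivAt_radKernel fun r => hasDerivAt_radRem hs r)
      (fun s hs => hasDerivAt_radKernel fun r => hasDerivAt_radRem₁ hs r)
      (fun δ hδ => ⟨22 / δ, by positivity, fun s hs x y =>
        norm_radKernel_le (by positivity) (fun r hr =>
          (norm_radRem₂_le hσ' (hδ.trans_le hs) hr).trans (by gcongr)) x y⟩) ht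
  have d₁ (t : ℝ) (ht : 0 < t) : HasDerivAt Γ₁ (Γ₂ t) t :=
    hasDerivAt_of_hasKernel hA hA0 k₁ k₂ i₁ i₂
      (fun s hs => hasDerivAt_radKernel fun r => hasDerivAt_radRem₁ hs r)
      (fun s hs => hasDerivAt_radKernel fun r => hasDerivAt_radRem₂ hs r)
      (fun δ hδ => ⟨98 / δ ^ 2, by positivity, fun s hs x y =>
        norm_radKernel_le (by positivity) (fun r hr =>
          (norm_radRem₃_le hσ' (hδ.trans_le hs) hr).trans (by gcongr)) x y⟩) ht
  have e (t : ℝ) (ht : 0 < t) : deriv Γ₀ =ᶠ[nhds t] Γ₁ := by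
    filter_upwards [lt_mem_nhds ht] with s hs using (d₀ s hs).deriv
  have d₂ (t : ℝ) (ht : 0 < t) : HasDerivAt (deriv Γ₀) (Γ₂ t) t :=
    (d₁ t ht).congr_of_eventuallyEq (e t ht)
  refine ⟨Γ₀, fun t ht x y => ?_, fun t ht f => ?_, fun t ht => (d₀ t ht).differentiableAt,
    fun t ht => (d₂ t ht).differentiableAt, fun t ht => ?_⟩
  · have hI : ((∫ z : EuclideanSpace ℝ (Fin 3), |V z| : ℝ) : ℂ) ≠ 0 := by exact_mod_cast hV1.ne'
    simp only [Gamma1ker, Complex.ofReal_inv]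
    field_simp
    ring
  · refine (k₀ t ht f).trans (.of_forall fun x => integral_congr_ae ?_)
    filter_upwards [Measure.ae_ne volume x] with y hy
    rw [radKernel_radRem_eq ht hy.symm]
  · have n₀ := (k₀ t ht).norm_le hA hA0 (by positivity) (b₀ t ht)
    have n₁ := (k₁ t ht).norm_le hA hA0 (by positivity) (b₁ t ht)
    have n₂ := (k₂ t ht).norm_le hA hA0 (by positivity) (b₂ t ht)
    rw [(d₀ t ht).deriv, (d₂ t ht).deriv]
    calc ‖Γ₀ t‖ + t * ‖Γ₁ t‖ + t ^ 2 * ‖Γ₂ t‖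
        ≤ 2 * t * S + t * (6 * S) + t ^ 2 * (22 / t * S) := by gcongr
      _ = 30 * S * t := by field_simp; ring
      _ ≤ (30 * S + 1) * t := by nlinarith
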